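/- arXiv:1603.05035 — 6 statements merged into one kernel-verified Lean document; each statement's English description precedes it below -/
import Mathlib

section
/- (Potential walls.) Let s, q ∈ ℝ and let v, w ∈ ℝ³. Then: (1) Z_{s,q}(v) and Z_{s,q}(w) are ℝ-linearly dependent in ℂ if and only if v, w and (1, s, q) are ℝ-linearly dependent in ℝ³; (2) if moreover Z_{s,q}(v) ≠ 0 and Z_{s,q}(w) ≠ 0, then Z_{s,q}(v) and Z_{s,q}(w) lie on the same ray from the origin (i.e. there exists t > 0 with Z_{s,q}(v) = t·Z_{s,q}(w)) if and only if there exist real numbers a > 0 and b > 0 such that a·v − b·w ∈ ℝ·(1, s, q). -/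
/-- The central charge `Z_{s,q} : ℝ³ → ℂ`,
`Z_{s,q}(v) = (−ch₂(v) + q·ch₀(v)) + i·(ch₁(v) − s·ch₀(v))`,
where `v = (ch₀ v, ch₁ v, ch₂ v)`. -/
noncomputable def Zmap (s q : ℝ) (v : ℝ × ℝ × ℝ) : ℂ :=
  ⟨-v.2.2 + q * v.1, v.2.1 - s * v.1⟩

theorem Zmap_combination_eq_zero_iff (s q a b : ℝ) (v w : ℝ × ℝ × ℝ) :
    a • Zmap s q v + b • Zmap s q w = 0 ↔ ∃ c : ℝ, a • v + b • w = c • ((1 : ℝ), s, q) := by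
  obtain ⟨v₀, v₁, v₂⟩ := v
  obtain ⟨w₀, w₁, w₂⟩ := w
  simp only [Zmap, Complex.ext_iff, Complex.add_re, Complex.add_im, Complex.smul_re,
    Complex.smul_im, Complex.zero_re, Complex.zero_im, smul_eq_mul, Prod.smul_mk, Prod.mk_add_mk,
    Prod.mk.injEq]
  constructor
  · rintro ⟨hre, him⟩
    exact ⟨a * v₀ + b * w₀, by ring, by linear_combination him, by linear_combination -hre⟩
  · rintro ⟨c, h₀, h₁, h₂⟩
    exact ⟨by linear_combination q * h₀ - h₂, by linear_combination h₁ - s * h₀⟩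

theorem linearIndependent_Zmap_iff (s q : ℝ) (v w : ℝ × ℝ × ℝ) :
    LinearIndependent ℝ ![Zmap s q v, Zmap s q w] ↔
      LinearIndependent ℝ ![v, w, ((1 : ℝ), s, q)] := by
  rw [LinearIndependent.pair_iff, Fintype.linearIndependent_iff]
  simp only [Fin.sum_univ_three, Matrix.cons_val]
  constructor
  · intro h g hg
    obtain ⟨h₀, h₁⟩ := h (g 0) (g 1) ((Zmap_combination_eq_zero_iff s q _ _ v w).2
      ⟨-g 2, by rw [neg_smul]; exact eq_neg_of_add_eq_zero_left hg⟩)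
    have h₂ : g 2 = 0 := by simpa [h₀, h₁] using congrArg Prod.fst hg
    intro i
    fin_cases i <;> assumption
  · intro h a b hab
    obtain ⟨c, hc⟩ := (Zmap_combination_eq_zero_iff s q a b v w).1 hab
    have hg := h ![a, b, -c] (by simp [hc])
    exact ⟨hg 0, hg 1⟩

/-- Potential walls: (1) `Z_{s,q}(v)` and `Z_{s,q}(w)` are ℝ-linearly dependent in ℂ iff
`v`, `w`, `(1,s,q)` are ℝ-linearly dependent in ℝ³; (2) if both central charges are nonzero,
they lie on the same ray from the origin iff there exist `a, b > 0` with
`a·v − b·w ∈ ℝ·(1,s,q)`. -/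
theorem potential_walls (s q : ℝ) (v w : ℝ × ℝ × ℝ) :
    (¬ LinearIndependent ℝ ![Zmap s q v, Zmap s q w] ↔
      ¬ LinearIndependent ℝ ![v, w, ((1 : ℝ), s, q)]) ∧
    (Zmap s q v ≠ 0 → Zmap s q w ≠ 0 →
      ((∃ t : ℝ, 0 < t ∧ Zmap s q v = t • Zmap s q w) ↔
        (∃ a b : ℝ, 0 < a ∧ 0 < b ∧ ∃ c : ℝ, a • v - b • w = c • ((1 : ℝ), s, q)))) := by
  refine ⟨not_congr (linearIndependent_Zmap_iff s q v w), fun _ _ => ⟨?_, ?_⟩⟩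
  · rintro ⟨t, ht, h⟩
    obtain ⟨c, hc⟩ := (Zmap_combination_eq_zero_iff s q 1 (-t) v w).1 (by simp [h])
    exact ⟨1, t, one_pos, ht, c, by simpa [sub_eq_add_neg] using hc⟩
  · rintro ⟨a, b, ha, hb, c, hc⟩
    have h := (Zmap_combination_eq_zero_iff s q a (-b) v w).2
      ⟨c, by rw [neg_smul, ← sub_eq_add_neg, hc]⟩
    rw [neg_smul, ← sub_eq_add_neg, sub_eq_zero] at h
    refine ⟨a⁻¹ * b, by positivity, ?_⟩
    rw [mul_smul, ← h, inv_smul_smul₀ ha.ne']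
end

section
/- For every dyadic rational q, the exceptional character ṽ(q) satisfies ch₀(ṽ(q)) ≥ 1 and χ(ṽ(q), ṽ(q)) = 1; equivalently, ch₁(ṽ(q))² − 2·ch₀(ṽ(q))·ch₂(ṽ(q)) = ch₀(ṽ(q))² − 1. -/
/-- The Euler pairing (Hirzebruch–Riemann–Roch on P²) on `K(P²)⊗ℝ ≅ ℝ³`,
identifying `v = (ch₀ v, ch₁ v, ch₂ v)`. -/
noncomputable def chi (v w : ℝ × ℝ × ℝ) : ℝ :=
  v.2.2 * w.1 + w.2.2 * v.1 - v.2.1 * w.2.1 + (3 / 2) * (w.2.1 * v.1 - w.1 * v.2.1) + v.1 * w.1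

/-- `vtil m p` is the exceptional character `ṽ(p / 2^m) ∈ ℝ³`, defined recursively:
`ṽ(n) = (1, n, n²/2)` for integers `n`; for odd `p` and `m > 0`,
if `p ≡ 3 (mod 4)` then `ṽ(p/2^m) = 3·ch₀(ṽ((p+1)/2^m))·ṽ((p−1)/2^m) − ṽ((p−3)/2^m)`,
and if `p ≡ 1 (mod 4)` then `ṽ(p/2^m) = 3·ch₀(ṽ((p−1)/2^m))·ṽ((p+1)/2^m) − ṽ((p+3)/2^m)`.
For even `p` we reduce the fraction, so `vtil` is well defined on dyadic rationals
(each dyadic rational `q` is represented as `p / 2^m`). -/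
noncomputable def vtil : ℕ → ℤ → ℝ × ℝ × ℝ
  | 0, p => (1, (p : ℝ), (p : ℝ) ^ 2 / 2)
  | m + 1, p =>
    if p % 2 = 0 then vtil m (p / 2)
    else if p % 4 = 3 then
      (3 * (vtil m ((p + 1) / 2)).1) • vtil m ((p - 1) / 2) - vtil m ((p - 3) / 2)
    else
      (3 * (vtil m ((p - 1) / 2)).1) • vtil m ((p + 1) / 2) - vtil m ((p + 3) / 2)

theorem chi_smul_sub_left (t : ℝ) (u v w : ℝ × ℝ × ℝ) :
    chi (t • u - v) w = t * chi u w - chi v w := by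
  simp only [chi, Prod.fst_sub, Prod.snd_sub, Prod.smul_fst, Prod.smul_snd, smul_eq_mul]
  ring

theorem chi_smul_sub_right (t : ℝ) (u v w : ℝ × ℝ × ℝ) :
    chi w (t • u - v) = t * chi w u - chi w v := by
  simp only [chi, Prod.fst_sub, Prod.snd_sub, Prod.smul_fst, Prod.smul_snd, smul_eq_mul]
  ring

/-- A numerically exceptional triple whose ranks are at least one, are largest in the middle,
and determine the remaining Euler pairings. -/
structure IsMarkovTriple (a b c : ℝ × ℝ × ℝ) : Prop where
  one_le_left : 1 ≤ a.1
  one_le_right : 1 ≤ c.1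
  left_le_mid : a.1 ≤ b.1
  right_le_mid : c.1 ≤ b.1
  chi_left_left : chi a a = 1
  chi_mid_mid : chi b b = 1
  chi_right_right : chi c c = 1
  chi_mid_left : chi b a = 0
  chi_right_mid : chi c b = 0
  chi_right_left : chi c a = 0
  chi_left_mid : chi a b = 3 * c.1
  chi_mid_right : chi b c = 3 * a.1
  chi_left_right : chi a c = 9 * a.1 * c.1 - 3 * b.1

/-- Left mutation of the last member of a triple through the middle one. -/
theorem IsMarkovTriple.mutate_right {a b c : ℝ × ℝ × ℝ} (h : IsMarkovTriple a b c) :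
    IsMarkovTriple a ((3 * a.1) • b - c) b := by
  obtain ⟨ha, hc, hab, hcb, haa, hbb, hcc, hba, hcb0, hca, hab3, hbc, hac⟩ := h
  have hw : ((3 * a.1) • b - c).1 = 3 * a.1 * b.1 - c.1 := by simp
  have hbw : b.1 ≤ 3 * a.1 * b.1 - c.1 := by nlinarith
  constructor <;> try simp only [chi_smul_sub_left, chi_smul_sub_right, hw, haa, hbb, hcc, hba, hcb0,
    hca, hab3, hbc, hac]
  all_goals linarith

/-- Right mutation of the first member of a triple through the middle one. -/
theorem IsMarkovTriple.mutate_left {a b c : ℝ × ℝ × ℝ} (h : IsMarkovTriple a b c) :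
    IsMarkovTriple b ((3 * c.1) • b - a) c := by
  obtain ⟨ha, hc, hab, hcb, haa, hbb, hcc, hba, hcb0, hca, hab3, hbc, hac⟩ := h
  have hw : ((3 * c.1) • b - a).1 = 3 * c.1 * b.1 - a.1 := by simp
  have hbw : b.1 ≤ 3 * c.1 * b.1 - a.1 := by nlinarith
  constructor <;> try simp only [chi_smul_sub_left, chi_smul_sub_right, hw, haa, hbb, hcc, hba, hcb0,
    hca, hab3, hbc, hac]
  all_goals linarith

theorem vtil_succ_two_mul (m : ℕ) (k : ℤ) : vtil (m + 1) (2 * k) = vtil m k := by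
  simp [vtil]

theorem vtil_succ_of_odd {m : ℕ} {k : ℤ} (hk : k % 2 = 1) :
    vtil (m + 1) (2 * k + 1) = (3 * (vtil m (k + 1)).1) • vtil m k - vtil m (k - 1) := by
  rw [vtil, if_neg (by omega), if_pos (by omega), show (2 * k + 1 + 1) / 2 = k + 1 by omega,
    show (2 * k + 1 - 1) / 2 = k by omega, show (2 * k + 1 - 3) / 2 = k - 1 by omega]

theorem vtil_succ_of_even {m : ℕ} {k : ℤ} (hk : k % 2 = 0) :
    vtil (m + 1) (2 * k + 1) = (3 * (vtil m k).1) • vtil m (k + 1) - vtil m (k + 2) := by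
  rw [vtil, if_neg (by omega), if_neg (by omega), show (2 * k + 1 + 1) / 2 = k + 1 by omega,
    show (2 * k + 1 - 1) / 2 = k by omega, show (2 * k + 1 + 3) / 2 = k + 2 by omega]

theorem isMarkovTriple_vtil (m : ℕ) {p : ℤ} (hp : p % 2 = 1) :
    IsMarkovTriple (vtil m (p - 1)) (vtil m p) (vtil m (p + 1)) := by
  induction m generalizing p with
  | zero =>
    constructor <;> simp only [vtil, chi] <;> push_cast <;> first | ring1 | norm_num
  | succ m ih =>
    obtain ⟨k, rfl⟩ : ∃ k, p = 2 * k + 1 := ⟨p / 2, by omega⟩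
    rw [show 2 * k + 1 - 1 = 2 * k by ring, show 2 * k + 1 + 1 = 2 * (k + 1) by ring,
      vtil_succ_two_mul, vtil_succ_two_mul]
    rcases Int.emod_two_eq_zero_or_one k with hk | hk
    · rw [vtil_succ_of_even hk]
      have h := ih (p := k + 1) (by omega)
      rw [show k + 1 - 1 = k by ring, show k + 1 + 1 = k + 2 by ring] at h
      exact h.mutate_right
    · rw [vtil_succ_of_odd hk]
      exact (ih hk).mutate_left

/-- Every exceptional character `ṽ(q)` (for a dyadic rational `q = p/2^m`) satisfies
`ch₀(ṽ(q)) ≥ 1` and `χ(ṽ(q), ṽ(q)) = 1`; equivalently,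
`ch₁(ṽ(q))² − 2·ch₀(ṽ(q))·ch₂(ṽ(q)) = ch₀(ṽ(q))² − 1`. -/
theorem exceptional_character_unit_selfpairing (m : ℕ) (p : ℤ) :
    1 ≤ (vtil m p).1 ∧
    chi (vtil m p) (vtil m p) = 1 ∧
    (vtil m p).2.1 ^ 2 - 2 * (vtil m p).1 * (vtil m p).2.2 = (vtil m p).1 ^ 2 - 1 := by
  have key : 1 ≤ (vtil m p).1 ∧ chi (vtil m p) (vtil m p) = 1 := by
    rcases Int.emod_two_eq_zero_or_one p with hp | hp
    · have h := isMarkovTriple_vtil m (p := p + 1) (by omega)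
      rw [add_sub_cancel_right] at h
      exact ⟨h.one_le_left, h.chi_left_left⟩
    · have h := isMarkovTriple_vtil m hp
      exact ⟨h.one_le_left.trans h.left_le_mid, h.chi_mid_mid⟩
  refine ⟨key.1, key.2, ?_⟩
  have h := key.2
  unfold chi at h
  linear_combination -h
end

section
/- For every dyadic rational q one has ṽ(q + 1) = σ(ṽ(q)); that is, the exceptional character associated to q + 1 is obtained from the one associated to q by twisting by O(1). -/
/-- The twist by `O(1)`: `σ(v)`, the Chern character of `V ⊗ O(1)`. -/
noncomputable def sigmaTwist (v : ℝ × ℝ × ℝ) : ℝ × ℝ × ℝ :=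
  (v.1, v.2.1 + v.1, v.2.2 + v.2.1 + (1 / 2) * v.1)

lemma sigmaTwist_smul_sub (c : ℝ) (v w : ℝ × ℝ × ℝ) :
    sigmaTwist (c • v - w) = c • sigmaTwist v - sigmaTwist w := by
  ext <;> simp [sigmaTwist] <;> ring

lemma vtil_zero_twist (p : ℤ) : vtil 0 (p + 1) = sigmaTwist (vtil 0 p) := by
  ext <;> simp [vtil, sigmaTwist]
  ring

/-- At half-integers both branches of the recursion agree. -/
lemma vtil_one_odd (n : ℤ) :
    vtil 1 (2 * n + 1) = (2, 2 * (n : ℝ) + 1, (n : ℝ) ^ 2 + n - 1 / 2) := by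
  have hodd : ¬ (2 * n + 1) % 2 = 0 := by omega
  rw [vtil, if_neg hodd]
  split_ifs
  · rw [show (2 * n + 1 + 1) / 2 = n + 1 by omega, show (2 * n + 1 - 1) / 2 = n by omega,
      show (2 * n + 1 - 3) / 2 = n - 1 by omega]
    ext <;> simp [vtil] <;> ring
  · rw [show (2 * n + 1 + 1) / 2 = n + 1 by omega, show (2 * n + 1 - 1) / 2 = n by omega,
      show (2 * n + 1 + 3) / 2 = n + 2 by omega]
    ext <;> simp [vtil] <;> ring

/-- For every dyadic rational `q = p/2^m` one has `ṽ(q + 1) = σ(ṽ(q))`: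
the exceptional character of `q + 1 = (p + 2^m)/2^m` is obtained from the one of `q`
by twisting by `O(1)`. -/
theorem exceptional_character_twist_by_one (m : ℕ) (p : ℤ) :
    vtil m (p + 2 ^ m) = sigmaTwist (vtil m p) := by
  induction m generalizing p with
  | zero => exact vtil_zero_twist p
  | succ m ih =>
    have hpow : (2 : ℤ) ^ (m + 1) = 2 * 2 ^ m := by ring
    have hdiv (a : ℤ) : (a + 2 ^ (m + 1)) / 2 = a / 2 + 2 ^ m := by omega
    by_cases heven : p % 2 = 0
    · have heven' : (p + 2 ^ (m + 1)) % 2 = 0 := by omega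
      rw [vtil, vtil, if_pos heven, if_pos heven', hdiv, ih]
    · obtain _ | k := m
      · obtain ⟨n, rfl⟩ : ∃ n, p = 2 * n + 1 := ⟨p / 2, by omega⟩
        rw [show 2 * n + 1 + 2 ^ (0 + 1) = 2 * (n + 1) + 1 by ring, zero_add,
          vtil_one_odd, vtil_one_odd]
        ext <;> simp [sigmaTwist] <;> ring
      · have hpow' : (2 : ℤ) ^ (k + 1) = 2 * 2 ^ k := by ring
        have hodd : ¬ (p + 2 ^ (k + 1 + 1)) % 2 = 0 := by omega
        have hmod : (p + 2 ^ (k + 1 + 1)) % 4 = p % 4 := by omega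
        have hadd (c : ℤ) : (p + 2 ^ (k + 1 + 1) + c) / 2 = (p + c) / 2 + 2 ^ (k + 1) := by
          omega
        have hsub (c : ℤ) : (p + 2 ^ (k + 1 + 1) - c) / 2 = (p - c) / 2 + 2 ^ (k + 1) := by
          omega
        have hfst (v : ℝ × ℝ × ℝ) : (sigmaTwist v).1 = v.1 := rfl
        rw [vtil, if_neg hodd, hmod, vtil.eq_2 p (k + 1), if_neg heven]
        simp only [hadd, hsub, ih, hfst]
        split_ifs <;> rw [sigmaTwist_smul_sub]
end

section
/- For every dyadic rational q, writing r := ch₀(ṽ(q)), one has Δ̄(ṽ(q)) = 1/2 − 1/(2r²), and the associated vertex point e⁺(q) := (1, ch₁(ṽ(q))/r, ch₂(ṽ(q))/r − 1/r²) satisfies Δ̄(e⁺(q)) = 1/2 + 1/(2r²); in particular 1/2 < Δ̄(e⁺(q)) ≤ 1, so every vertex e⁺ of the Le Potier curve lies in the region between the parabolas Δ̄ = 1/2 and Δ̄ = 1. -/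
/-- The reduced discriminant `Δ̄(v) = (ch₁(v)² − 2·ch₀(v)·ch₂(v))/(2·ch₀(v)²)`. -/
noncomputable def deltaBar (v : ℝ × ℝ × ℝ) : ℝ :=
  (v.2.1 ^ 2 - 2 * v.1 * v.2.2) / (2 * v.1 ^ 2)

/-- The vertex point `e⁺(q) = (1, ch₁(ṽ(q))/r, ch₂(ṽ(q))/r − 1/r²)` where `r = ch₀(ṽ(q))`. -/
noncomputable def ePlus (m : ℕ) (p : ℤ) : ℝ × ℝ × ℝ :=
  (1, (vtil m p).2.1 / (vtil m p).1, (vtil m p).2.2 / (vtil m p).1 - 1 / (vtil m p).1 ^ 2)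

/-- The symmetric part of the Euler pairing `χ` on Chern characters of the projective plane. -/
noncomputable def eulerSymm (v w : ℝ × ℝ × ℝ) : ℝ :=
  v.1 * w.1 + v.1 * w.2.2 + w.1 * v.2.2 - v.2.1 * w.2.1

/-- The determinant of the first two coordinates; `3/2` times it is the antisymmetric part of the
Euler pairing `χ`. -/
noncomputable def slopeDet (v w : ℝ × ℝ × ℝ) : ℝ :=
  v.1 * w.2.1 - w.1 * v.2.1

/-- Numerical properties of an exceptional triple `(a, b, c)` whose middle term has the
largest rank. They are stable under both mutations. -/
structure IsMarkovTriple_s7 (a b c : ℝ × ℝ × ℝ) : Prop where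
  one_le_left : 1 ≤ a.1
  one_le_right : 1 ≤ c.1
  left_le : a.1 ≤ b.1
  right_le : c.1 ≤ b.1
  self_left : eulerSymm a a = 1
  self_mid : eulerSymm b b = 1
  self_right : eulerSymm c c = 1
  symm_left_mid : eulerSymm a b = 3 / 2 * c.1
  symm_mid_right : eulerSymm b c = 3 / 2 * a.1
  symm_left_right : eulerSymm a c = 3 / 2 * (3 * a.1 * c.1 - b.1)
  det_left_mid : slopeDet a b = c.1
  det_mid_right : slopeDet b c = a.1
  det_left_right : slopeDet a c = 3 * a.1 * c.1 - b.1

namespace IsMarkovTriple_s7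

variable {a b c : ℝ × ℝ × ℝ}

theorem mutate_left_s7 (h : IsMarkovTriple_s7 a b c) :
    IsMarkovTriple_s7 a ((3 * a.1) • b - c) b := by
  obtain ⟨ha, hc, hab, hcb, haa, hbb, hcc, sab, sbc, sac, dab, dbc, dac⟩ := h
  simp only [eulerSymm, slopeDet] at *
  constructor <;> try simp only [eulerSymm, slopeDet, Prod.fst_sub, Prod.snd_sub, Prod.smul_fst,
    Prod.smul_snd, smul_eq_mul]
  · exact ha
  · linarith
  · nlinarith
  · nlinarith
  · exact haa
  · linear_combination 9 * a.1 ^ 2 * hbb - 6 * a.1 * sbc + hcc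
  · exact hbb
  · linear_combination 3 * a.1 * sab - sac
  · linear_combination 3 * a.1 * hbb - sbc
  · linear_combination sab
  · linear_combination 3 * a.1 * dab - dac
  · linear_combination dbc
  · linear_combination dab

theorem mutate_right_s7 (h : IsMarkovTriple_s7 a b c) :
    IsMarkovTriple_s7 b ((3 * c.1) • b - a) c := by
  obtain ⟨ha, hc, hab, hcb, haa, hbb, hcc, sab, sbc, sac, dab, dbc, dac⟩ := h
  simp only [eulerSymm, slopeDet] at *
  constructor <;> try simp only [eulerSymm, slopeDet, Prod.fst_sub, Prod.snd_sub, Prod.smul_fst,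
    Prod.smul_snd, smul_eq_mul]
  · linarith
  · exact hc
  · nlinarith
  · nlinarith
  · exact hbb
  · linear_combination 9 * c.1 ^ 2 * hbb - 6 * c.1 * sab + haa
  · exact hcc
  · linear_combination 3 * c.1 * hbb - sab
  · linear_combination 3 * c.1 * sbc - sac
  · linear_combination sbc
  · linear_combination dab
  · linear_combination 3 * c.1 * dbc - dac
  · linear_combination dbc

end IsMarkovTriple_s7

theorem vtil_succ_four_mul_add_one (m : ℕ) (k : ℤ) :
    vtil (m + 1) (4 * k + 1) =
      (3 * (vtil m (2 * k)).1) • vtil m (2 * k + 1) - vtil m (2 * k + 2) := by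
  rw [vtil, if_neg (by lia), if_neg (by lia), show (4 * k + 1 - 1) / 2 = 2 * k by lia,
    show (4 * k + 1 + 1) / 2 = 2 * k + 1 by lia, show (4 * k + 1 + 3) / 2 = 2 * k + 2 by lia]

theorem vtil_succ_four_mul_add_three (m : ℕ) (k : ℤ) :
    vtil (m + 1) (4 * k + 3) =
      (3 * (vtil m (2 * k + 2)).1) • vtil m (2 * k + 1) - vtil m (2 * k) := by
  rw [vtil, if_neg (by lia), if_pos (by lia), show (4 * k + 3 + 1) / 2 = 2 * k + 2 by lia,
    show (4 * k + 3 - 1) / 2 = 2 * k + 1 by lia, show (4 * k + 3 - 3) / 2 = 2 * k by lia]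

theorem isMarkovTriple_vtil_s7 (m : ℕ) (k : ℤ) :
    IsMarkovTriple_s7 (vtil m (2 * k)) (vtil m (2 * k + 1)) (vtil m (2 * k + 2)) := by
  induction m generalizing k with
  | zero =>
    constructor <;> simp only [vtil, eulerSymm, slopeDet] <;> push_cast <;> first | rfl | ring
  | succ m ih =>
    obtain ⟨j, rfl | rfl⟩ := Int.even_or_odd' k
    · rw [vtil_succ_two_mul, show 2 * (2 * j) + 1 = 4 * j + 1 by ring,
        vtil_succ_four_mul_add_one, show 2 * (2 * j) + 2 = 2 * (2 * j + 1) by ring,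
        vtil_succ_two_mul]
      exact (ih j).mutate_left_s7
    · rw [vtil_succ_two_mul, show 2 * (2 * j + 1) + 1 = 4 * j + 3 by ring,
        vtil_succ_four_mul_add_three, show 2 * (2 * j + 1) + 2 = 2 * (2 * j + 2) by ring,
        vtil_succ_two_mul]
      exact (ih j).mutate_right_s7

theorem one_le_vtil_fst_and_eulerSymm_self (m : ℕ) (p : ℤ) :
    1 ≤ (vtil m p).1 ∧ eulerSymm (vtil m p) (vtil m p) = 1 := by
  obtain ⟨k, rfl | rfl⟩ := Int.even_or_odd' p
  · have h := isMarkovTriple_vtil_s7 m k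
    exact ⟨h.one_le_left, h.self_left⟩
  · have h := isMarkovTriple_vtil_s7 m k
    exact ⟨h.one_le_left.trans h.left_le, h.self_mid⟩

/-- For every dyadic rational `q = p/2^m`, writing `r = ch₀(ṽ(q))`:
`Δ̄(ṽ(q)) = 1/2 − 1/(2r²)`, and the vertex `e⁺(q)` satisfies
`Δ̄(e⁺(q)) = 1/2 + 1/(2r²)`; in particular `1/2 < Δ̄(e⁺(q)) ≤ 1`, so every vertex of the
Le Potier curve lies between the parabolas `Δ̄ = 1/2` and `Δ̄ = 1`. -/
theorem ePlus_between_parabolas (m : ℕ) (p : ℤ) :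
    deltaBar (vtil m p) = 1 / 2 - 1 / (2 * (vtil m p).1 ^ 2) ∧
    deltaBar (ePlus m p) = 1 / 2 + 1 / (2 * (vtil m p).1 ^ 2) ∧
    1 / 2 < deltaBar (ePlus m p) ∧ deltaBar (ePlus m p) ≤ 1 := by
  obtain ⟨hr, hs⟩ := one_le_vtil_fst_and_eulerSymm_self m p
  have hr0 : (vtil m p).1 ≠ 0 := by positivity
  simp only [eulerSymm] at hs
  have hv : deltaBar (vtil m p) = 1 / 2 - 1 / (2 * (vtil m p).1 ^ 2) := by
    simp only [deltaBar]
    field_simp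
    linear_combination -hs
  have he : deltaBar (ePlus m p) = 1 / 2 + 1 / (2 * (vtil m p).1 ^ 2) := by
    simp only [deltaBar, ePlus]
    field_simp
    linear_combination -hs
  refine ⟨hv, he, ?_, ?_⟩
  · rw [he]
    exact lt_add_of_pos_right _ (by positivity)
  · have : 1 / (2 * (vtil m p).1 ^ 2) ≤ 1 / 2 :=
      one_div_le_one_div_of_le two_pos (by nlinarith)
    rw [he]
    linarith
end

section
/- (Positivity of the Euler pairing across a wide chord of the parabola Δ̄ = 1/2.) Let u, v ∈ ℝ³ satisfy ch₀(u) > 0, ch₀(v) > 0, Δ(u) = ch₀(u)² and Δ(v) = ch₀(v)² (i.e. both points lie on the parabola Δ̄ = 1/2). If |ch₁(u)/ch₀(u) − ch₁(v)/ch₀(v)| > 3, then χ(u, v) > 0 and χ(v, u) > 0. -/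
/-- The discriminant `Δ(v) = ch₁(v)² − 2·ch₀(v)·ch₂(v)`. -/
noncomputable def disc (v : ℝ × ℝ × ℝ) : ℝ := v.2.1 ^ 2 - 2 * v.1 * v.2.2

/-- On the parabola `Δ̄ = 1/2` the Euler pairing depends only on the ranks and on the
difference of the slopes. -/
theorem chi_eq_of_disc_eq_sq {u v : ℝ × ℝ × ℝ} (hu0 : u.1 ≠ 0) (hv0 : v.1 ≠ 0)
    (hu : disc u = u.1 ^ 2) (hv : disc v = v.1 ^ 2) :
    chi u v = u.1 * v.1 *
      ((v.2.1 / v.1 - u.2.1 / u.1) * (v.2.1 / v.1 - u.2.1 / u.1 + 3) / 2) := by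
  have hu2 : u.2.2 = (u.2.1 ^ 2 - u.1 ^ 2) / (2 * u.1) := by
    unfold disc at hu
    field_simp
    linarith
  have hv2 : v.2.2 = (v.2.1 ^ 2 - v.1 ^ 2) / (2 * v.1) := by
    unfold disc at hv
    field_simp
    linarith
  rw [chi, hu2, hv2]
  field_simp
  ring

/-- Positivity of the Euler pairing across a wide chord of the parabola `Δ̄ = 1/2`:
if `ch₀(u), ch₀(v) > 0`, `Δ(u) = ch₀(u)²`, `Δ(v) = ch₀(v)²` and the slopes `ch₁/ch₀`
differ by more than `3`, then `χ(u, v) > 0` and `χ(v, u) > 0`. -/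
theorem chi_pos_of_wide_chord (u v : ℝ × ℝ × ℝ)
    (hu0 : 0 < u.1) (hv0 : 0 < v.1)
    (hu : disc u = u.1 ^ 2) (hv : disc v = v.1 ^ 2)
    (h : |u.2.1 / u.1 - v.2.1 / v.1| > 3) :
    0 < chi u v ∧ 0 < chi v u := by
  have huv := chi_eq_of_disc_eq_sq hu0.ne' hv0.ne' hu hv
  have hvu := chi_eq_of_disc_eq_sq hv0.ne' hu0.ne' hv hu
  have hr : 0 < u.1 * v.1 := mul_pos hu0 hv0
  rw [huv, hvu, mul_comm v.1 u.1]
  rcases lt_abs.mp h with h | h <;>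
    exact ⟨mul_pos hr (by nlinarith), mul_pos hr (by nlinarith)⟩
end

section
/- (Negativity of the Euler pairing for characters on a wide chord.) Let x₁, x₂ ∈ ℝ with |x₁ − x₂| > 3 and set f₁ := (1, x₁, x₁²/2 − 1/2) and f₂ := (1, x₂, x₂²/2 − 1/2) in ℝ³ (two points on the parabola Δ̄ = 1/2). Let u, v ∈ ℝ³ lie in the real linear span of f₁ and f₂, and suppose χ(u, u) < 0, χ(v, v) < 0 and Δ(u, v) ≥ 0. Then χ(u, v) < 0 and χ(v, u) < 0. -/
/-- The (symmetric bilinear) discriminant pairing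
`Δ(v,w) = ch₁(v)·ch₁(w) − ch₀(v)·ch₂(w) − ch₀(w)·ch₂(v)`. -/
noncomputable def discPair (v w : ℝ × ℝ × ℝ) : ℝ :=
  v.2.1 * w.2.1 - v.1 * w.2.2 - w.1 * v.2.2

/-- Negativity of the Euler pairing for characters on a wide chord: with
`f₁ = (1, x₁, x₁²/2 − 1/2)` and `f₂ = (1, x₂, x₂²/2 − 1/2)` two points of the parabola
`Δ̄ = 1/2` with `|x₁ − x₂| > 3`, if `u, v` lie in the span of `f₁, f₂` and satisfy
`χ(u,u) < 0`, `χ(v,v) < 0`, `Δ(u,v) ≥ 0`, then `χ(u,v) < 0` and `χ(v,u) < 0`. -/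
theorem chi_neg_on_wide_chord (x₁ x₂ : ℝ) (hx : |x₁ - x₂| > 3)
    (u v : ℝ × ℝ × ℝ)
    (hu : u ∈ Submodule.span ℝ
      ({((1 : ℝ), x₁, x₁ ^ 2 / 2 - 1 / 2), ((1 : ℝ), x₂, x₂ ^ 2 / 2 - 1 / 2)} :
        Set (ℝ × ℝ × ℝ)))
    (hv : v ∈ Submodule.span ℝ
      ({((1 : ℝ), x₁, x₁ ^ 2 / 2 - 1 / 2), ((1 : ℝ), x₂, x₂ ^ 2 / 2 - 1 / 2)} :
        Set (ℝ × ℝ × ℝ)))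
    (huu : chi u u < 0) (hvv : chi v v < 0) (hΔ : 0 ≤ discPair u v) :
    chi u v < 0 ∧ chi v u < 0 := by
  obtain ⟨a, b, rfl⟩ := Submodule.mem_span_pair.1 hu
  obtain ⟨c, d, rfl⟩ := Submodule.mem_span_pair.1 hv
  simp only [chi, discPair, Prod.fst_add, Prod.snd_add, Prod.smul_fst, Prod.smul_snd,
    smul_eq_mul] at huu hvv hΔ ⊢
  have ht : 9 < (x₁ - x₂) ^ 2 := by
    rw [← sq_abs]
    nlinarith
  have hab : a * b < 0 := by
    by_contra! h
    nlinarith [mul_nonneg h (sq_nonneg (x₁ - x₂))]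
  have hcd : c * d < 0 := by
    by_contra! h
    nlinarith [mul_nonneg h (sq_nonneg (x₁ - x₂))]
  have hPQ : 0 < (x₁ - x₂) * (x₁ - x₂ - 3) ∧ 0 < (x₁ - x₂) * (x₁ - x₂ + 3) := by
    rcases lt_abs.1 hx with h | h <;> constructor <;> nlinarith
  obtain ⟨hP, hQ⟩ := hPQ
  have key : a * d < 0 ∧ b * c < 0 := by
    have same_sign : ¬ (a * c < 0 ∧ b * d < 0 ∧ 0 < a * d ∧ 0 < b * c) := by
      rintro ⟨hac, hbd, had, hbc⟩
      nlinarith [mul_pos (add_pos had hbc) (sub_pos.2 ht)]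
    rcases mul_neg_iff.1 hab with ⟨ha, hb⟩ | ⟨ha, hb⟩ <;>
    rcases mul_neg_iff.1 hcd with ⟨hc, hd⟩ | ⟨hc, hd⟩
    · exact ⟨mul_neg_of_pos_of_neg ha hd, mul_neg_of_neg_of_pos hb hc⟩
    · exact absurd ⟨mul_neg_of_pos_of_neg ha hc, mul_neg_of_neg_of_pos hb hd,
        mul_pos ha hd, mul_pos_of_neg_of_neg hb hc⟩ same_sign
    · exact absurd ⟨mul_neg_of_neg_of_pos ha hc, mul_neg_of_pos_of_neg hb hd,
        mul_pos_of_neg_of_neg ha hd, mul_pos hb hc⟩ same_sign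
    · exact ⟨mul_neg_of_neg_of_pos ha hd, mul_neg_of_pos_of_neg hb hc⟩
  obtain ⟨had, hbc⟩ := key
  constructor
  · linarith [mul_neg_of_neg_of_pos had hP, mul_neg_of_neg_of_pos hbc hQ]
  · linarith [mul_neg_of_neg_of_pos had hQ, mul_neg_of_neg_of_pos hbc hP]
end
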